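/- arXiv:math/0506265 — 2 statements merged into one kernel-verified Lean document; each statement's English description precedes it below -/
import Mathlib

section
/- Let A be a commutative noetherian local ring with maximal ideal m and residue field k = A/m. Assume m² = 0 and rank_k(m) ≥ 2. If M is a finitely generated A-module such that Ext^n_A(M,A) = 0 for some integer n ≥ 2, then M is a free A-module. -/
/-!
Statement 18: Let `A` be a commutative noetherian local ring with maximal ideal `m` and
residue field `k = A/m`. Assume `m² = 0` and `rank_k(m) ≥ 2`. If `M` is a finitely
generated `A`-module such that `Ext^n_A(M, A) = 0` for some `n ≥ 2`, then `M` is free.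

Since `m² = 0`, the `k`-vector space `m` is canonically isomorphic to the cotangent
space `m/m²`, so the rank hypothesis is expressed via `(maximalIdeal A).Cotangent`.
The vanishing of `Ext^n_A(M, A)` is expressed by saying that the `Ext`-module (defined
by deriving the Hom functor in the first variable) is a subsingleton.
-/

open CategoryTheory

lemma newExt_subsingleton (A : Type) [CommRing A] (X Y : ModuleCat.{0} A) (n : ℕ)
    (hext : Subsingleton (((Ext A (ModuleCat A) (n + 1)).obj (Opposite.op X)).obj Y)) :
    Subsingleton (Abelian.Ext.{0} X Y (n + 1)) := by
  let P := projectiveResolution X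
  have hz : Limits.IsZero ((P.complex.linearYonedaObj A Y).homology (n + 1)) :=
    (ModuleCat.isZero_of_subsingleton _).of_iso (P.isoExt (n + 1) Y).symm
  rw [← HomologicalComplex.exactAt_iff_isZero_homology,
    HomologicalComplex.exactAt_iff' _ n (n + 1) (n + 2) (by simp) (by simp),
    ShortComplex.moduleCat_exact_iff] at hz
  refine subsingleton_of_forall_eq 0 fun α => ?_
  obtain ⟨f, hf, rfl⟩ := P.extMk_surjective α (n + 2) rfl
  rw [P.extMk_eq_zero_iff f _ rfl hf n rfl]
  exact hz f hf

lemma newExt_shift (A : Type) [CommRing A] {F N : Type} [AddCommGroup F] [Module A F]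
    [AddCommGroup N] [Module A N] [Module.Projective A F] (g : F →ₗ[A] N)
    (hg : Function.Surjective g) (Y : ModuleCat.{0} A) (n : ℕ)
    (h : Subsingleton (Abelian.Ext.{0} (ModuleCat.of A N) Y (n + 1 + 1))) :
    Subsingleton (Abelian.Ext.{0} (ModuleCat.of A (LinearMap.ker g)) Y (n + 1)) := by
  have hS := LinearMap.shortExact_shortComplexKer hg
  have : Projective (ModuleCat.of A F) := (IsProjective.iff_projective F).1 inferInstance
  refine subsingleton_of_forall_eq 0 fun x => ?_
  obtain ⟨y, hy⟩ := Abelian.Ext.contravariant_sequence_exact₁ hS Y x (n₁ := n + 1 + 1)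
    (by omega) (h.elim _ _)
  rw [← hy]
  have : y = 0 := Abelian.Ext.eq_zero_of_projective (P := ModuleCat.of A F) y
  rw [this, Abelian.Ext.comp_zero]

lemma newExt_shift_zero (A : Type) [CommRing A] {F N : Type} [AddCommGroup F] [Module A F]
    [AddCommGroup N] [Module A N] (g : F →ₗ[A] N)
    (hg : Function.Surjective g)
    (h : Subsingleton (Abelian.Ext.{0} (ModuleCat.of A N) (ModuleCat.of A A) 1))
    (φ : LinearMap.ker g →ₗ[A] A) : ∃ ψ : F →ₗ[A] A, ∀ x : LinearMap.ker g, ψ x = φ x := by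
  have hS := LinearMap.shortExact_shortComplexKer hg
  obtain ⟨y, hy⟩ := Abelian.Ext.contravariant_sequence_exact₁ hS (ModuleCat.of A A)
    (Abelian.Ext.mk₀ (ModuleCat.ofHom φ)) (n₁ := 1) rfl (h.elim _ _)
  obtain ⟨ψ, rfl⟩ := (Abelian.Ext.mk₀_bijective _ _).2 y
  rw [Abelian.Ext.mk₀_comp_mk₀] at hy
  have hy := (Abelian.Ext.mk₀_bijective _ _).1 hy
  refine ⟨ψ.hom, fun x => ?_⟩
  exact congrArg (fun f => f.hom x) hy

lemma newExt_retract (A : Type) [CommRing A] {K N : Type} [AddCommGroup K] [Module A K]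
    [AddCommGroup N] [Module A N] (i : K →ₗ[A] N) (r : N →ₗ[A] K) (hri : r ∘ₗ i = LinearMap.id)
    (Y : ModuleCat.{0} A) (n : ℕ)
    (h : Subsingleton (Abelian.Ext.{0} (ModuleCat.of A N) Y n)) :
    Subsingleton (Abelian.Ext.{0} (ModuleCat.of A K) Y n) := by
  refine subsingleton_of_forall_eq 0 fun x => ?_
  have h1 : ModuleCat.ofHom i ≫ ModuleCat.ofHom r = 𝟙 (ModuleCat.of A K) := by
    rw [← ModuleCat.ofHom_comp, hri]; rfl
  rw [← Abelian.Ext.mk₀_id_comp x, ← h1, ← Abelian.Ext.mk₀_comp_mk₀_assoc,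
    h.elim ((Abelian.Ext.mk₀ (ModuleCat.ofHom r)).comp x (zero_add n)) 0, Abelian.Ext.comp_zero]

lemma exists_retract (A : Type) [CommRing A] (m : Ideal A) [hm : m.IsMaximal] {N : Type}
    [AddCommGroup N] [Module A N] (hN : ∀ a ∈ m, ∀ y : N, a • y = 0) (x : N) (hx : x ≠ 0) :
    ∃ (i : (A ⧸ m) →ₗ[A] N) (r : N →ₗ[A] (A ⧸ m)), r ∘ₗ i = LinearMap.id ∧
      ∀ a : A, i (Ideal.Quotient.mk m a) = a • x := by
  have ht : Module.IsTorsionBySet A N m := fun y a => hN a a.2 y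
  letI : Module (A ⧸ m) N := ht.module
  haveI : IsScalarTower A (A ⧸ m) N := ht.isScalarTower
  letI : Field (A ⧸ m) := Ideal.Quotient.field m
  have hinj : LinearMap.ker (LinearMap.toSpanSingleton (A ⧸ m) N x) = ⊥ :=
    LinearMap.ker_toSpanSingleton _ hx
  obtain ⟨r, hr⟩ := LinearMap.exists_leftInverse_of_injective _ hinj
  refine ⟨(LinearMap.toSpanSingleton (A ⧸ m) N x).restrictScalars A, r.restrictScalars A, ?_, ?_⟩
  · ext
    exact congrArg (fun f => f 1) hr
  · intro a
    exact Module.IsTorsionBySet.mk_smul ht a x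

lemma minimal_cover (A : Type) [CommRing A] [IsLocalRing A]
    (M : Type) [AddCommGroup M] [Module A M] [Module.Finite A M] :
    ∃ (ι : Type) (_ : Fintype ι) (g : (ι → A) →ₗ[A] M), Function.Surjective g ∧
      ∀ v, g v = 0 → ∀ i, v i ∈ IsLocalRing.maximalIdeal A := by
  let k := IsLocalRing.ResidueField A
  let w := Module.Free.chooseBasis k (TensorProduct A k M)
  have ⟨v, eq⟩ := (TensorProduct.mk_surjective A M k Ideal.Quotient.mk_surjective).comp_left w
  have hs := IsLocalRing.span_eq_top_of_tmul_eq_basis v w (congr_fun eq)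
  refine ⟨_, inferInstance, Fintype.linearCombination A v, ?_, ?_⟩
  · rw [← LinearMap.range_eq_top, Fintype.range_linearCombination, hs]
  · intro u hu i
    rw [← IsLocalRing.residue_eq_zero_iff]
    have h1 := congrArg (TensorProduct.mk A k M 1) hu
    rw [Fintype.linearCombination_apply, map_sum, map_zero] at h1
    refine Fintype.linearIndependent_iff.1 w.linearIndependent
      (fun i => IsLocalRing.residue A (u i)) ?_ i
    rw [← h1]
    refine Finset.sum_congr rfl fun j _ => ?_
    rw [map_smul, ← congr_fun eq j]
    exact algebraMap_smul k (u j) _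

lemma newExt_residue (A : Type) [CommRing A] [IsLocalRing A]
    (hm2 : (IsLocalRing.maximalIdeal A) ^ 2 = ⊥)
    (hrank : 2 ≤ Module.rank (A ⧸ IsLocalRing.maximalIdeal A)
      (IsLocalRing.maximalIdeal A).Cotangent) (n : ℕ)
    (h : Subsingleton (Abelian.Ext.{0} (ModuleCat.of A (A ⧸ IsLocalRing.maximalIdeal A))
      (ModuleCat.of A A) (n + 1))) : False := by
  set m := IsLocalRing.maximalIdeal A with hmdef
  have hmul : ∀ a ∈ m, ∀ b ∈ m, a * b = 0 := fun a ha b hb => by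
    have : a * b ∈ m ^ 2 := by rw [sq]; exact Ideal.mul_mem_mul ha hb
    rwa [hm2] at this
  have hker : ∀ y : LinearMap.ker m.mkQ, (y : A) ∈ m := fun y => by
    exact (Submodule.ker_mkQ m).le y.2
  have hN : ∀ a ∈ m, ∀ y : LinearMap.ker m.mkQ, a • y = 0 := fun a ha y =>
    Subtype.ext (hmul a ha y (hker y))
  have hx : ∃ x : LinearMap.ker m.mkQ, x ≠ 0 := by
    by_contra! hc
    have h0 : ∀ a ∈ m, a = 0 := fun a ha =>
      congrArg Subtype.val (hc ⟨a, by rw [Submodule.ker_mkQ]; exact ha⟩)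
    have : Subsingleton m.Cotangent := by
      refine subsingleton_of_forall_eq 0 fun c => ?_
      obtain ⟨a, rfl⟩ := m.toCotangent_surjective c
      rw [show a = 0 from Subtype.ext (h0 a a.2), map_zero]
    rw [rank_subsingleton'] at hrank
    simp at hrank
  obtain ⟨x, hx⟩ := hx
  obtain ⟨i, r, hri, hi⟩ := exists_retract A m hN x hx
  induction n with
  | succ n ih =>
    exact ih (newExt_retract A i r hri _ _ (newExt_shift A m.mkQ m.mkQ_surjective _ _ h))
  | zero =>
    obtain ⟨ψ, hψ⟩ := newExt_shift_zero A m.mkQ m.mkQ_surjective h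
      ((LinearMap.ker m.mkQ).subtype ∘ₗ i ∘ₗ r)
    have hψ1 : ∀ y : LinearMap.ker m.mkQ, ψ 1 * y = i (r y) := fun y => by
      have := hψ y
      rw [← mul_one (y : A), ← smul_eq_mul, map_smul] at this
      rw [mul_comm]; exact this
    have hrx : r x = 1 := by
      have h1 := hi 1
      rw [one_smul] at h1
      rw [← h1]
      exact congrArg (fun f => f 1) hri
    have hunit : IsUnit (ψ 1) := by
      by_contra hu
      have hu : ψ 1 ∈ m := hu
      apply hx
      have h1 := hψ1 x
      rw [hmul _ hu _ (hker x), hrx] at h1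
      have h2 := hi 1
      rw [one_smul, map_one] at h2
      rw [← h2]
      exact Subtype.ext h1.symm
    obtain ⟨u, hu⟩ := hunit
    have hspan : ∀ y ∈ m, ∃ a : A, y = a * x := fun y hy => by
      have h1 := hψ1 ⟨y, by rw [Submodule.ker_mkQ]; exact hy⟩
      obtain ⟨a, ha⟩ := Ideal.Quotient.mk_surjective (r ⟨y, by rw [Submodule.ker_mkQ]; exact hy⟩)
      rw [← ha, hi, ← hu] at h1
      refine ⟨↑u⁻¹ * a, ?_⟩
      rw [mul_assoc]
      exact (Units.eq_inv_mul_iff_mul_eq u).2 h1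
    have hle : Module.rank (A ⧸ m) m.Cotangent ≤ 1 := by
      letI : Field (A ⧸ m) := Ideal.Quotient.field m
      refine rank_le_one_iff.2 ⟨m.toCotangent ⟨x, hker x⟩, fun c => ?_⟩
      obtain ⟨⟨y, hy⟩, rfl⟩ := m.toCotangent_surjective c
      obtain ⟨a, rfl⟩ := hspan y hy
      refine ⟨Ideal.Quotient.mk m a, ?_⟩
      exact (map_smul m.toCotangent a ⟨x, hker x⟩).symm
    have := hrank.trans hle
    norm_num at this

theorem statement18 (A : Type) [CommRing A] [IsNoetherianRing A] [IsLocalRing A]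
    (hm2 : (IsLocalRing.maximalIdeal A) ^ 2 = ⊥)
    (hrank : 2 ≤ Module.rank (A ⧸ IsLocalRing.maximalIdeal A)
      (IsLocalRing.maximalIdeal A).Cotangent)
    (M : Type) [AddCommGroup M] [Module A M] [Module.Finite A M]
    (n : ℕ) (hn : 2 ≤ n)
    (hext : Subsingleton (((Ext A (ModuleCat A) n).obj
      (Opposite.op (ModuleCat.of A M))).obj (ModuleCat.of A A))) :
    Module.Free A M := by
  obtain ⟨n, rfl⟩ : ∃ j, n = j + 1 + 1 := ⟨n - 2, by omega⟩
  have h := newExt_subsingleton A _ _ _ hext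
  obtain ⟨ι, _, g, hg, hker⟩ := minimal_cover A M
  have h := newExt_shift A g hg _ _ h
  by_cases hb : LinearMap.ker g = ⊥
  · exact Module.Free.of_equiv (LinearEquiv.ofBijective g ⟨LinearMap.ker_eq_bot.1 hb, hg⟩)
  · exfalso
    obtain ⟨x, hx, hx0⟩ := Submodule.exists_mem_ne_zero_of_ne_bot hb
    have hN : ∀ a ∈ IsLocalRing.maximalIdeal A, ∀ y : LinearMap.ker g, a • y = 0 := by
      intro a ha y
      refine Subtype.ext (funext fun i => ?_)
      have : a * y.1 i ∈ IsLocalRing.maximalIdeal A ^ 2 := by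
        rw [sq]; exact Ideal.mul_mem_mul ha (hker y.1 y.2 i)
      rwa [hm2] at this
    obtain ⟨i, r, hri, -⟩ := exists_retract A (IsLocalRing.maximalIdeal A) hN ⟨x, hx⟩
      (fun h => hx0 (congrArg Subtype.val h))
    exact newExt_residue A hm2 hrank n (newExt_retract A i r hri _ _ h)
end

section
/- Let R be a ring whose finitistic global dimension is finite, i.e. there exists an integer d such that every R-module of finite projective dimension has projective dimension at most d. Then an acyclic complex X of projective R-modules is homotopy equivalent to zero (i.e. isomorphic to 0 in the homotopy category K(R)) if and only if for some integer s the R-module Coker(X^{s−1} → X^s) is projective. -/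
/-!
Statement 19: Let `R` be a ring whose finitistic global dimension is finite, i.e. there
is `d` such that every `R`-module of finite projective dimension has projective
dimension at most `d`. Then an acyclic complex `X` of projective `R`-modules is
homotopy equivalent to zero if and only if for some integer `s` the module
`Coker(X^{s-1} → X^s)` is projective.

Projective dimension bounds are expressed through the vanishing of the `Ext`-functors
(`pd M ≤ d` iff `Ext^k(M, N) = 0` for all `k > d` and all modules `N`); since `R` need
not be commutative, we use the `ℤ`-linear `Ext` functors of the abelian category of
`R`-modules.
-/

open CategoryTheory CategoryTheory.Limits

/-- `pdLE R M d` : the `R`-module `M` has projective dimension at most `d`, expressed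
via vanishing of `Ext^k(M, -)` for `k > d`. -/
def pdLE (R : Type) [Ring R] (M : ModuleCat R) (d : ℕ) : Prop :=
  ∀ (N : ModuleCat R) (k : ℕ), d < k →
    Subsingleton (((Ext ℤ (ModuleCat R) k).obj (Opposite.op M)).obj N)


section Helpers

/-- `Ext^(n+1)(M, N)` vanishes iff cocycles of a projective resolution are coboundaries. -/
lemma subsingleton_ext_iff (R : Type) [Ring R] (M N : ModuleCat R)
    (P : ProjectiveResolution M) (n : ℕ) :
    Subsingleton (((Ext ℤ (ModuleCat R) (n + 1)).obj (Opposite.op M)).obj N) ↔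
      ∀ f : P.complex.X (n + 1) ⟶ N, P.complex.d (n + 2) (n + 1) ≫ f = 0 →
        ∃ g : P.complex.X n ⟶ N, P.complex.d (n + 1) n ≫ g = f := by
  rw [← ModuleCat.isZero_iff_subsingleton, (P.isoExt (R := ℤ) (n + 1) N).isZero_iff,
    ← HomologicalComplex.exactAt_iff_isZero_homology,
    HomologicalComplex.exactAt_iff' _ n (n + 1) (n + 2) (by simp) (by simp),
    ShortComplex.moduleCat_exact_iff]
  rfl

lemma pdLE_iff (R : Type) [Ring R] (M : ModuleCat R) (d : ℕ) :
    pdLE R M d ↔ HasProjectiveDimensionLT M (d + 1) := by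
  let := HasExt.standard (ModuleCat R)
  let P := projectiveResolution M
  rw [hasProjectiveDimensionLT_iff]
  constructor
  · intro h k hk Y e
    obtain ⟨n, rfl⟩ : ∃ n, k = n + 1 := ⟨k - 1, by omega⟩
    obtain ⟨f, hf, rfl⟩ := P.extMk_surjective e (n + 2) rfl
    rw [P.extMk_eq_zero_iff f _ _ hf n rfl]
    exact (subsingleton_ext_iff R M Y P n).1 (h Y (n + 1) (by omega)) f hf
  · intro h N k hk
    obtain ⟨n, rfl⟩ : ∃ n, k = n + 1 := ⟨k - 1, by omega⟩
    rw [subsingleton_ext_iff R M N P n]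
    intro f hf
    exact (P.extMk_eq_zero_iff f (n + 2) rfl hf n rfl).1 (h (n + 1) (by omega) _)

variable {R : Type} [Ring R] (X : CochainComplex (ModuleCat.{0} R) ℤ)

/-- The short complex `C^j → X^i → C^i` where `i = j + 1` and `C = Coker`. -/
noncomputable def cokSC (j i : ℤ) : ShortComplex (ModuleCat R) :=
  ShortComplex.mk (X.fromOpcycles j i) (X.pOpcycles i) (by
    rw [← cancel_epi (X.pOpcycles j)]
    simp)

lemma cokSC_shortExact (hacyclic : ∀ n : ℤ, IsZero (X.homology n)) (j i : ℤ) (h : j + 1 = i) :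
    (cokSC X j i).ShortExact := by
  obtain rfl : j = i - 1 := by omega
  have hm : Mono (X.fromOpcycles (i - 1) i) := by
    have h1 : (X.sc (i - 1)).Exact := by
      rw [ShortComplex.exact_iff_isZero_homology]; exact hacyclic (i - 1)
    have h2 := h1.mono_fromOpcycles
    have hn : (ComplexShape.up ℤ).next (i - 1) = i := by simp
    have h3 : Mono (X.fromOpcycles (i - 1) ((ComplexShape.up ℤ).next (i - 1))) := by
      have he : X.fromOpcycles (i - 1) ((ComplexShape.up ℤ).next (i - 1)) =
          (X.sc (i - 1)).fromOpcycles := by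
        refine (cancel_epi (X.pOpcycles (i - 1))).1 ?_
        exact (X.p_fromOpcycles _ _).trans ((X.sc (i - 1)).p_fromOpcycles).symm
      rw [he]
      exact h2
    rwa [hn] at h3
  have hepi : Epi (cokSC X (i - 1) i).g := inferInstanceAs (Epi (X.pOpcycles i))
  have hmono : Mono (cokSC X (i - 1) i).f := hm
  refine ShortComplex.ShortExact.mk ?_
  let S' := ShortComplex.mk (X.d (i - 1) i) (X.pOpcycles i) (by simp)
  have hS' : S'.Exact :=
    S'.exact_of_g_is_cokernel (X.opcyclesIsCokernel (i - 1) i (by simp))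
  let φ : S' ⟶ cokSC X (i - 1) i :=
    { τ₁ := X.pOpcycles (i - 1)
      τ₂ := 𝟙 _
      τ₃ := 𝟙 _
      comm₁₂ := by simp [S', cokSC]
      comm₂₃ := by simp [S', cokSC] }
  have : Epi φ.τ₁ := inferInstanceAs (Epi (X.pOpcycles (i - 1)))
  have : IsIso φ.τ₂ := inferInstanceAs (IsIso (𝟙 _))
  have : Mono φ.τ₃ := inferInstanceAs (Mono (𝟙 _))
  exact (ShortComplex.exact_iff_of_epi_of_isIso_of_mono φ).1 hS'

/-- The opcycles are the cokernel. -/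
noncomputable def opcIso (s : ℤ) : X.opcycles s ≅ cokernel (X.d (s - 1) s) :=
  (X.opcyclesIsCokernel (s - 1) s (by simp)).coconePointUniqueUpToIso
    (colimit.isColimit _)

lemma opc_projective_of_homotopy (hproj : ∀ n : ℤ, Projective (X.X n))
    (h : Homotopy (𝟙 X) 0) (n : ℤ) : Projective (X.opcycles n) := by
  have := hproj (n + 1)
  refine Retract.projective (Y := X.X (n + 1))
    { i := X.fromOpcycles n (n + 1)
      r := h.hom (n + 1) n ≫ X.pOpcycles n
      retract := ?_ }
  rw [← cancel_epi (X.pOpcycles n)]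
  have hc := h.comm n
  rw [dNext_eq h.hom (show (ComplexShape.up ℤ).Rel n (n + 1) by simp),
    prevD_eq h.hom (show (ComplexShape.up ℤ).Rel (n - 1) n by simp)] at hc
  have := congrArg (· ≫ X.pOpcycles n) hc
  simp at this
  simpa using this.symm

lemma homotopy_of_opc_projective (hacyclic : ∀ n : ℤ, IsZero (X.homology n))
    (hp : ∀ n, Projective (X.opcycles n)) : Nonempty (Homotopy (𝟙 X) 0) := by
  have sp (j i : ℤ) (h : j + 1 = i) : Nonempty (cokSC X j i).Splitting :=
    have : Projective (cokSC X j i).X₃ := hp i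
    ⟨(cokSC_shortExact X hacyclic j i h).splittingOfProjective⟩
  have key : ∀ j i : ℤ, ∃ (r : X.X i ⟶ X.opcycles j) (s : X.opcycles i ⟶ X.X i), j + 1 = i →
      (X.fromOpcycles j i ≫ r = 𝟙 _ ∧ s ≫ X.pOpcycles i = 𝟙 _ ∧
        r ≫ X.fromOpcycles j i + X.pOpcycles i ≫ s = 𝟙 _) := by
    intro j i
    by_cases h : j + 1 = i
    · obtain ⟨σ⟩ := sp j i h
      exact ⟨σ.r, σ.s, fun _ => ⟨σ.f_r, σ.s_g, σ.id⟩⟩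
    · exact ⟨0, 0, fun h' => absurd h' h⟩
  choose r s hrs using key
  let H (i j : ℤ) (_ : (ComplexShape.up ℤ).Rel j i) : X.X i ⟶ X.X j := r j i ≫ s (j - 1) j
  have e : 𝟙 X = Homotopy.nullHomotopicMap' H := by
    ext1 n
    rw [Homotopy.nullHomotopicMap'_f (k₂ := n - 1) (k₁ := n) (k₀ := n + 1) (by simp) (by simp)]
    have h1 := hrs (n - 1) n (by omega)
    have h2 := hrs n (n + 1) rfl
    have h3 := hrs (n - 1 - 1) (n - 1) (by omega)
    simp only [H, HomologicalComplex.id_f]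
    rw [← X.p_fromOpcycles n (n + 1), ← X.p_fromOpcycles (n - 1) n, ← h1.2.2]
    simp only [Category.assoc]
    rw [reassoc_of% h2.1, reassoc_of% h3.2.1, add_comm]
  exact ⟨(Homotopy.ofEq e).trans (Homotopy.nullHomotopy' H)⟩

lemma opc_projective (hfindim : ∃ d : ℕ, ∀ M : ModuleCat R, (∃ e : ℕ, pdLE R M e) → pdLE R M d)
    (hproj : ∀ n : ℤ, Projective (X.X n))
    (hacyclic : ∀ n : ℤ, IsZero (X.homology n)) (s : ℤ) (hs : Projective (X.opcycles s)) (n : ℤ) :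
    Projective (X.opcycles n) := by
  obtain ⟨d, hd⟩ := hfindim
  have hX (n : ℤ) : HasProjectiveDimensionLT (X.X n) 1 := by
    have := hproj n
    infer_instance
  have up (k : ℕ) : HasProjectiveDimensionLT (X.opcycles (s + k)) (k + 1) := by
    induction k with
    | zero =>
      have : HasProjectiveDimensionLT (X.opcycles s) 1 := inferInstance
      simpa using this
    | succ k ih =>
      have hS := cokSC_shortExact X hacyclic (s + k) (s + (k + 1 : ℕ)) (by push_cast; ring)
      exact hS.hasProjectiveDimensionLT_X₃ (k + 1) ih
        (have := hX (s + (k + 1 : ℕ)); hasProjectiveDimensionLT_of_ge (X.X (s + (k + 1 : ℕ))) 1 _ (by omega))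
  have down (k : ℕ) : ∀ m : ℤ, HasProjectiveDimensionLT (X.opcycles (m + k)) (d + 1) →
      HasProjectiveDimensionLT (X.opcycles m) (d - k + 1) := by
    induction k with
    | zero => intro m h; simpa using h
    | succ k ih =>
      intro m h
      have h' := ih (m + 1) (by convert h using 2; push_cast; ring)
      have hS := cokSC_shortExact X hacyclic m (m + 1) rfl
      refine hS.hasProjectiveDimensionLT_X₁ _
        (have := hX (m + 1); hasProjectiveDimensionLT_of_ge (X.X (m + 1)) 1 _ (by omega))
        (have := h'; hasProjectiveDimensionLT_of_ge (X.opcycles (m + 1)) (d - k + 1) _ (by omega))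
  have all (m : ℤ) (hm : s ≤ m) : HasProjectiveDimensionLT (X.opcycles m) (d + 1) := by
    obtain ⟨k, rfl⟩ := Int.le.dest hm
    rw [← pdLE_iff]
    exact hd _ ⟨k, (pdLE_iff _ _ _).2 (up k)⟩
  let k : ℕ := d + (s - n).toNat
  have := down k n (all _ (by omega))
  rw [projective_iff_hasProjectiveDimensionLT_one]
  simpa [k] using this

end Helpers

theorem statement19 (R : Type) [Ring R]
    (hfindim : ∃ d : ℕ, ∀ M : ModuleCat R, (∃ e : ℕ, pdLE R M e) → pdLE R M d)
    (X : CochainComplex (ModuleCat R) ℤ)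
    (hproj : ∀ n : ℤ, Projective (X.X n))
    (hacyclic : ∀ n : ℤ, IsZero (X.homology n)) :
    IsZero ((HomotopyCategory.quotient (ModuleCat R) (ComplexShape.up ℤ)).obj X) ↔
      ∃ s : ℤ, Projective (cokernel (X.d (s - 1) s)) := by
  rw [HomotopyCategory.isZero_quotient_obj_iff]
  constructor
  · rintro ⟨h⟩
    exact ⟨0, Projective.of_iso (opcIso X 0) (opc_projective_of_homotopy X hproj h 0)⟩
  · rintro ⟨s, hs⟩
    exact homotopy_of_opc_projective X hacyclic (opc_projective X hfindim hproj hacyclic s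
      (Projective.of_iso (opcIso X s).symm hs))
end
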